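/- arXiv:1706.05607 — 3 statements merged into one kernel-verified Lean document; each statement's English description precedes it below -/
import Mathlib

section
/- Let S be the string rewriting system constructed from a given GPCP instance as described. Then there exists a string W ∈ Σ̂* such that ¢_1 W ↔*_S ¢_2 W if and only if the GPCP instance has a solution. (This is the correctness of the many-one reduction underlying the theorem that the Common Term problem is undecidable for dwindling convergent string rewriting systems.) -/
/-- The two-letter alphabet Γ = {a, b} of the GPCP instance. -/
inductive Γ : Type where
  | a : Γ
  | b : Γ

/-- The alphabet Σ̂ = {a₁,a₂,a₃,b₁,b₂,b₃,¢₁,¢₂,B} ∪ {c₀,…,c_{n+1}}. -/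
inductive Ltr (n : ℕ) : Type where
  | a1 : Ltr n
  | a2 : Ltr n
  | a3 : Ltr n
  | b1 : Ltr n
  | b2 : Ltr n
  | b3 : Ltr n
  | cent1 : Ltr n
  | cent2 : Ltr n
  | B : Ltr n
  | c : Fin (n + 2) → Ltr n

/-- The homomorphism h₁ : Γ* → Σ̂*, h₁(a) = a₁a₂a₃, h₁(b) = b₁b₂b₃. -/
def h1 {n : ℕ} (w : List Γ) : List (Ltr n) :=
  w.flatMap fun g => match g with
    | Γ.a => [Ltr.a1, Ltr.a2, Ltr.a3]
    | Γ.b => [Ltr.b1, Ltr.b2, Ltr.b3]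

/-- The homomorphism h₂ : Γ* → Σ̂*, h₂(a) = a₁a₂, h₂(b) = b₁b₂. -/
def h2 {n : ℕ} (w : List Γ) : List (Ltr n) :=
  w.flatMap fun g => match g with
    | Γ.a => [Ltr.a1, Ltr.a2]
    | Γ.b => [Ltr.b1, Ltr.b2]

/-- The homomorphism h₃ : Γ* → Σ̂*, h₃(a) = a₁, h₃(b) = b₁. -/
def h3 {n : ℕ} (w : List Γ) : List (Ltr n) :=
  w.flatMap fun g => match g with
    | Γ.a => [Ltr.a1]
    | Γ.b => [Ltr.b1]

/-- One-step rewrite relation of a string rewriting system `R`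
(a set of rules `(l, r)`): `u →_R v` iff `u = x l y` and `v = x r y`. -/
def OneStep {α : Type*} (R : Set (List α × List α)) (u v : List α) : Prop :=
  ∃ x y l r : List α, (l, r) ∈ R ∧ u = x ++ l ++ y ∧ v = x ++ r ++ y

/-- `u →*_R v`: reflexive-transitive closure of the one-step rewrite relation. -/
def RewStar {α : Type*} (R : Set (List α × List α)) : List α → List α → Prop :=
  Relation.ReflTransGen (OneStep R)

/-- `u ↔*_R v`: the Thue congruence, i.e. the reflexive-transitive-symmetric
closure of the one-step rewrite relation. -/
def ThueCong {α : Type*} (R : Set (List α × List α)) : List α → List α → Prop :=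
  Relation.EqvGen (OneStep R)

/-- The rules of the string rewriting system `S` constructed from the GPCP
instance with dominoes `(x i, y i)` for `i = 0, …, n+1`. -/
inductive SRule (n : ℕ) (x y : Fin (n + 2) → List Γ) :
    List (Ltr n) → List (Ltr n) → Prop where
  /- Class D rules -/
  | D1 (g : Γ) : SRule n x y ([Ltr.cent1] ++ h1 [g]) ([Ltr.cent1] ++ h3 [g])
  | D2 (g : Γ) : SRule n x y ([Ltr.cent2] ++ h1 [g]) ([Ltr.cent2] ++ h2 [g])
  | D3 (g g' : Γ) : SRule n x y (h2 [g] ++ h1 [g']) (h2 [g] ++ h2 [g'])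
  | D4 (g g' : Γ) : SRule n x y (h3 [g] ++ h1 [g']) (h3 [g] ++ h3 [g'])
  /- Class I rules -/
  | I1 : SRule n x y ([Ltr.cent1] ++ h3 (x 0) ++ [Ltr.B, Ltr.c 0]) []
  | I2 : SRule n x y ([Ltr.cent2] ++ h2 (y 0) ++ [Ltr.c 0]) []
  /- Class II rules -/
  | II1 (i : Fin (n + 2)) (hi : 1 ≤ (i : ℕ)) (hn : (i : ℕ) ≤ n) :
      SRule n x y (h3 (x i) ++ [Ltr.B, Ltr.c i]) []
  | II2 (i : Fin (n + 2)) (hi : 1 ≤ (i : ℕ)) (hn : (i : ℕ) ≤ n) :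
      SRule n x y (h2 (y i) ++ [Ltr.c i, Ltr.B]) []
  /- Class III rules -/
  | III1 : SRule n x y (h3 (x (Fin.last (n + 1))) ++ [Ltr.c (Fin.last (n + 1))]) []
  | III2 : SRule n x y (h2 (y (Fin.last (n + 1))) ++ [Ltr.c (Fin.last (n + 1)), Ltr.B]) []

/-- The string rewriting system `S` as a set of rules. -/
def SSys (n : ℕ) (x y : Fin (n + 2) → List Γ) : Set (List (Ltr n) × List (Ltr n)) :=
  {p | SRule n x y p.1 p.2}

/-- The GPCP instance `(x i, y i)_{i = 0,…,n+1}` (with start domino index `0`,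
end domino index `n+1` and intermediate dominoes `1,…,n`) has a solution:
a sequence of indices `i₁, …, i_k ∈ {1, …, n}` with
`x₀ x_{i₁} ⋯ x_{i_k} x_{n+1} = y₀ y_{i₁} ⋯ y_{i_k} y_{n+1}`. -/
def GPCPSolvable (n : ℕ) (x y : Fin (n + 2) → List Γ) : Prop :=
  ∃ L : List (Fin (n + 2)), (∀ i ∈ L, 1 ≤ (i : ℕ) ∧ (i : ℕ) ≤ n) ∧
    x 0 ++ L.flatMap x ++ x (Fin.last (n + 1)) =
      y 0 ++ L.flatMap y ++ y (Fin.last (n + 1))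

namespace CommonTerm

variable {n : ℕ}

/-- The letter `g₁`. -/
def l1 : Γ → Ltr n
  | Γ.a => Ltr.a1
  | Γ.b => Ltr.b1

/-- The letter `g₂`. -/
def l2 : Γ → Ltr n
  | Γ.a => Ltr.a2
  | Γ.b => Ltr.b2

/-- The letter `g₃`. -/
def l3 : Γ → Ltr n
  | Γ.a => Ltr.a3
  | Γ.b => Ltr.b3

@[simp] lemma l1_inj {g g' : Γ} : (l1 g : Ltr n) = l1 g' ↔ g = g' := by
  cases g <;> cases g' <;> simp [l1]
@[simp] lemma l2_inj {g g' : Γ} : (l2 g : Ltr n) = l2 g' ↔ g = g' := by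
  cases g <;> cases g' <;> simp [l2]
@[simp] lemma l3_inj {g g' : Γ} : (l3 g : Ltr n) = l3 g' ↔ g = g' := by
  cases g <;> cases g' <;> simp [l3]
@[simp] lemma l1_ne_l2 {g g' : Γ} : (l1 g : Ltr n) ≠ l2 g' := by
  cases g <;> cases g' <;> simp [l1, l2]
@[simp] lemma l1_ne_l3 {g g' : Γ} : (l1 g : Ltr n) ≠ l3 g' := by
  cases g <;> cases g' <;> simp [l1, l3]
@[simp] lemma l2_ne_l3 {g g' : Γ} : (l2 g : Ltr n) ≠ l3 g' := by
  cases g <;> cases g' <;> simp [l2, l3]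
@[simp] lemma l2_ne_l1 {g g' : Γ} : (l2 g : Ltr n) ≠ l1 g' := l1_ne_l2.symm
@[simp] lemma l3_ne_l1 {g g' : Γ} : (l3 g : Ltr n) ≠ l1 g' := l1_ne_l3.symm
@[simp] lemma l3_ne_l2 {g g' : Γ} : (l3 g : Ltr n) ≠ l2 g' := l2_ne_l3.symm

/-- Letters that are not of the form `g₁`, `g₂` or `g₃`. -/
def IsMarker (z : Ltr n) : Prop :=
  ∀ g, z ≠ l1 g ∧ z ≠ l2 g ∧ z ≠ l3 g

lemma isMarker_cent1 : IsMarker (Ltr.cent1 : Ltr n) := by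
  intro g; cases g <;> simp [l1, l2, l3]
lemma isMarker_cent2 : IsMarker (Ltr.cent2 : Ltr n) := by
  intro g; cases g <;> simp [l1, l2, l3]
lemma isMarker_B : IsMarker (Ltr.B : Ltr n) := by
  intro g; cases g <;> simp [l1, l2, l3]
lemma isMarker_c (i : Fin (n + 2)) : IsMarker (Ltr.c i : Ltr n) := by
  intro g; cases g <;> simp [l1, l2, l3]

@[simp] lemma cent1_ne_l1 {g} : (Ltr.cent1 : Ltr n) ≠ l1 g := (isMarker_cent1 g).1
@[simp] lemma cent1_ne_l2 {g} : (Ltr.cent1 : Ltr n) ≠ l2 g := (isMarker_cent1 g).2.1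
@[simp] lemma cent1_ne_l3 {g} : (Ltr.cent1 : Ltr n) ≠ l3 g := (isMarker_cent1 g).2.2
@[simp] lemma cent2_ne_l1 {g} : (Ltr.cent2 : Ltr n) ≠ l1 g := (isMarker_cent2 g).1
@[simp] lemma cent2_ne_l2 {g} : (Ltr.cent2 : Ltr n) ≠ l2 g := (isMarker_cent2 g).2.1
@[simp] lemma cent2_ne_l3 {g} : (Ltr.cent2 : Ltr n) ≠ l3 g := (isMarker_cent2 g).2.2
@[simp] lemma B_ne_l1 {g} : (Ltr.B : Ltr n) ≠ l1 g := (isMarker_B g).1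
@[simp] lemma B_ne_l2 {g} : (Ltr.B : Ltr n) ≠ l2 g := (isMarker_B g).2.1
@[simp] lemma B_ne_l3 {g} : (Ltr.B : Ltr n) ≠ l3 g := (isMarker_B g).2.2
@[simp] lemma c_ne_l1 {i g} : (Ltr.c i : Ltr n) ≠ l1 g := (isMarker_c i g).1
@[simp] lemma c_ne_l2 {i g} : (Ltr.c i : Ltr n) ≠ l2 g := (isMarker_c i g).2.1
@[simp] lemma c_ne_l3 {i g} : (Ltr.c i : Ltr n) ≠ l3 g := (isMarker_c i g).2.2
@[simp] lemma l1_ne_cent1 {g} : l1 g ≠ (Ltr.cent1 : Ltr n) := cent1_ne_l1.symm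
@[simp] lemma l2_ne_cent1 {g} : l2 g ≠ (Ltr.cent1 : Ltr n) := cent1_ne_l2.symm
@[simp] lemma l1_ne_cent2 {g} : l1 g ≠ (Ltr.cent2 : Ltr n) := cent2_ne_l1.symm
@[simp] lemma l2_ne_cent2 {g} : l2 g ≠ (Ltr.cent2 : Ltr n) := cent2_ne_l2.symm
@[simp] lemma l1_ne_B {g} : l1 g ≠ (Ltr.B : Ltr n) := B_ne_l1.symm
@[simp] lemma l2_ne_B {g} : l2 g ≠ (Ltr.B : Ltr n) := B_ne_l2.symm
@[simp] lemma l3_ne_B {g} : l3 g ≠ (Ltr.B : Ltr n) := B_ne_l3.symm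
@[simp] lemma l1_ne_c {i g} : l1 g ≠ (Ltr.c i : Ltr n) := c_ne_l1.symm
@[simp] lemma l2_ne_c {i g} : l2 g ≠ (Ltr.c i : Ltr n) := c_ne_l2.symm
@[simp] lemma l3_ne_c {i g} : l3 g ≠ (Ltr.c i : Ltr n) := c_ne_l3.symm

@[simp] lemma h1_nil : (h1 [] : List (Ltr n)) = [] := rfl
@[simp] lemma h2_nil : (h2 [] : List (Ltr n)) = [] := rfl
@[simp] lemma h3_nil : (h3 [] : List (Ltr n)) = [] := rfl
@[simp] lemma h1_cons (g : Γ) (w : List Γ) :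
    (h1 (g :: w) : List (Ltr n)) = l1 g :: l2 g :: l3 g :: h1 w := by
  cases g <;> rfl
@[simp] lemma h2_cons (g : Γ) (w : List Γ) :
    (h2 (g :: w) : List (Ltr n)) = l1 g :: l2 g :: h2 w := by
  cases g <;> rfl
@[simp] lemma h3_cons (g : Γ) (w : List Γ) :
    (h3 (g :: w) : List (Ltr n)) = l1 g :: h3 w := by
  cases g <;> rfl
@[simp] lemma h2_append (u v : List Γ) :
    (h2 (u ++ v) : List (Ltr n)) = h2 u ++ h2 v := List.flatMap_append
@[simp] lemma h3_append (u v : List Γ) :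
    (h3 (u ++ v) : List (Ltr n)) = h3 u ++ h3 v := List.flatMap_append

lemma mem_h2 {w : List Γ} {z : Ltr n} (h : z ∈ h2 w) : ∃ g, z = l1 g ∨ z = l2 g := by
  induction w with
  | nil => simp at h
  | cons g w ih =>
    simp only [h2_cons, List.mem_cons] at h
    rcases h with h | h | h
    exacts [⟨g, .inl h⟩, ⟨g, .inr h⟩, ih h]

lemma mem_h3 {w : List Γ} {z : Ltr n} (h : z ∈ h3 w) : ∃ g, z = l1 g := by
  induction w with
  | nil => simp at h
  | cons g w ih =>
    simp only [h3_cons, List.mem_cons] at h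
    rcases h with h | h
    exacts [⟨g, h⟩, ih h]

lemma IsMarker.notMem_h2 {z : Ltr n} (hz : IsMarker z) (w : List Γ) : z ∉ h2 w := fun h => by
  obtain ⟨g, h | h⟩ := mem_h2 h
  exacts [(hz g).1 h, (hz g).2.1 h]

lemma IsMarker.notMem_h3 {z : Ltr n} (hz : IsMarker z) (w : List Γ) : z ∉ h3 w := fun h => by
  obtain ⟨g, h⟩ := mem_h3 h
  exact (hz g).1 h

@[simp] lemma cent1_notMem_h2 (w : List Γ) : (Ltr.cent1 : Ltr n) ∉ h2 w :=
  isMarker_cent1.notMem_h2 w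
@[simp] lemma cent1_notMem_h3 (w : List Γ) : (Ltr.cent1 : Ltr n) ∉ h3 w :=
  isMarker_cent1.notMem_h3 w
@[simp] lemma cent2_notMem_h2 (w : List Γ) : (Ltr.cent2 : Ltr n) ∉ h2 w :=
  isMarker_cent2.notMem_h2 w
@[simp] lemma cent2_notMem_h3 (w : List Γ) : (Ltr.cent2 : Ltr n) ∉ h3 w :=
  isMarker_cent2.notMem_h3 w

@[simp] lemma l2_notMem_h3 {g : Γ} (w : List Γ) : (l2 g : Ltr n) ∉ h3 w := fun h => by
  obtain ⟨g', h⟩ := mem_h3 h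
  simp at h

lemma h3_inj {u v : List Γ} : (h3 u : List (Ltr n)) = h3 v ↔ u = v := by
  refine ⟨fun h => ?_, fun h => h ▸ rfl⟩
  induction u generalizing v with
  | nil => cases v <;> simp_all
  | cons g u ih =>
    cases v with
    | nil => simp at h
    | cons g' v => simp at h; rw [h.1, ih h.2]

lemma h2_inj {u v : List Γ} : (h2 u : List (Ltr n)) = h2 v ↔ u = v := by
  refine ⟨fun h => ?_, fun h => h ▸ rfl⟩
  induction u generalizing v with
  | nil => cases v <;> simp_all
  | cons g u ih =>
    cases v with
    | nil => simp at h
    | cons g' v => simp at h; rw [h.1, ih h.2]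

lemma h3_split {w : List Γ} {Z A T : List (Ltr n)} {g : Γ} (hZ : ∀ g, l1 g ∉ Z)
    (h : h3 w ++ Z = A ++ l1 g :: T) :
    ∃ p q, w = p ++ g :: q ∧ A = h3 p ∧ T = h3 q ++ Z := by
  induction w generalizing A with
  | nil => exact absurd (by simp at h; simp [h]) (hZ g)
  | cons g' w ih =>
    cases A with
    | nil =>
      simp at h
      exact ⟨[], w, by simp [h.1], rfl, h.2.symm⟩
    | cons e A =>
      simp at h
      obtain ⟨p, q, rfl, rfl, rfl⟩ := ih h.2
      exact ⟨g' :: p, q, by simp [← h.1]⟩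

lemma h2_split_l1 {w : List Γ} {Z A T : List (Ltr n)} {g : Γ} (hZ : ∀ g, l1 g ∉ Z)
    (h : h2 w ++ Z = A ++ l1 g :: T) : ∃ T', T = l2 g :: T' := by
  induction w generalizing A with
  | nil => exact absurd (by simp at h; simp [h]) (hZ g)
  | cons g' w ih =>
    match A with
    | [] =>
      simp at h
      exact ⟨_, by rw [← h.2, h.1]⟩
    | [e] => simp at h
    | e :: e' :: A =>
      simp at h
      exact ih h.2.2

lemma h2_split_l2 {w : List Γ} {Z A T : List (Ltr n)} {g : Γ} (hZ : ∀ g, l2 g ∉ Z)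
    (h : h2 w ++ Z = A ++ l2 g :: T) :
    ∃ p q, w = p ++ g :: q ∧ A = h2 p ++ [l1 g] ∧ T = h2 q ++ Z := by
  induction w generalizing A with
  | nil => exact absurd (by simp at h; simp [h]) (hZ g)
  | cons g' w ih =>
    match A with
    | [] => simp at h
    | [e] =>
      simp at h
      exact ⟨[], w, by simp [← h.1, h.2]⟩
    | e :: e' :: A =>
      simp at h
      obtain ⟨p, q, rfl, rfl, rfl⟩ := ih h.2.2
      exact ⟨g' :: p, q, by simp [← h.1, ← h.2.1]⟩

lemma suffix_h3 {e : Ltr n} {P : List (Ltr n)} {p u : List Γ}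
    (h : P ++ h3 p = e :: h3 u) (he : ∀ g, e ≠ l1 g) :
    ∃ u', u = u' ++ p ∧ P = e :: h3 u' := by
  induction p using List.reverseRecOn generalizing u with
  | nil => exact ⟨u, by simp_all⟩
  | append_singleton p g ih =>
    rcases List.eq_nil_or_concat' u with rfl | ⟨u, g', rfl⟩
    · have := congrArg List.reverse h
      simp at this
      exact absurd this.1.symm (he g)
    · have h' : (P ++ h3 p) ++ [l1 g] = (e :: h3 u) ++ [l1 g'] := by simpa using h
      obtain ⟨h'', hg⟩ := List.append_inj' h' rfl
      obtain ⟨u', rfl, rfl⟩ := ih h''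
      exact ⟨u', by simp at hg; simp [hg]⟩

lemma suffix_h2 {e : Ltr n} {P : List (Ltr n)} {p u : List Γ}
    (h : P ++ h2 p = e :: h2 u) :
    ∃ u', u = u' ++ p ∧ P = e :: h2 u' := by
  induction p using List.reverseRecOn generalizing u with
  | nil => exact ⟨u, by simp_all⟩
  | append_singleton p g ih =>
    rcases List.eq_nil_or_concat' u with rfl | ⟨u, g', rfl⟩
    · have := congrArg List.reverse h
      simp at this
    · have h' : (P ++ h2 p) ++ [l1 g, l2 g] = (e :: h2 u) ++ [l1 g', l2 g'] := by simpa using h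
      obtain ⟨h'', hg⟩ := List.append_inj' h' rfl
      obtain ⟨u', rfl, rfl⟩ := ih h''
      exact ⟨u', by simp at hg; simp [hg]⟩

section Rules

variable {x y : Fin (n + 2) → List Γ} {l r l' r' : List (Ltr n)}

lemma _root_.SRule.dwindling (h : SRule n x y l r) : ∃ t, t ≠ [] ∧ l = r ++ t := by
  cases h <;> first
    | exact ⟨[l2 _, l3 _], by simp, by simp⟩
    | exact ⟨[l3 _], by simp, by simp; rfl⟩
    | simp

lemma _root_.SRule.not_cent_mem {A T : List (Ltr n)} {e : Ltr n} (h : SRule n x y l r)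
    (he : e = Ltr.cent1 ∨ e = Ltr.cent2) (hl : l = A ++ e :: T) : A = [] := by
  cases A with
  | nil => rfl
  | cons z A =>
    exfalso
    have hm : e ∈ l.tail := by simp [hl]
    clear hl
    cases h
    case D1 | D2 | D3 | D4 | I1 | I2 => rcases he with rfl | rfl <;> simp at hm
    all_goals
      replace hm := List.mem_of_mem_tail hm
      rcases he with rfl | rfl <;> simp at hm

lemma exists_h3_concat {w : List Γ} (hw : w ≠ []) :
    ∃ w' g, (h3 w : List (Ltr n)) = h3 w' ++ [l1 g] := by
  rcases List.eq_nil_or_concat' w with rfl | ⟨w', g, rfl⟩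
  · exact absurd rfl hw
  · exact ⟨w', g, by simp⟩

lemma exists_h2_concat {w : List Γ} (hw : w ≠ []) :
    ∃ w' g, (h2 w : List (Ltr n)) = h2 w' ++ [l1 g, l2 g] := by
  rcases List.eq_nil_or_concat' w with rfl | ⟨w', g, rfl⟩
  · exact absurd rfl hw
  · exact ⟨w', g, by simp⟩

lemma _root_.SRule.unique (hy : ∀ i, y i ≠ []) {P P' : List (Ltr n)}
    (h : SRule n x y l r) (h' : SRule n x y l' r') (e : P ++ l = P' ++ l') :
    P ++ r = P' ++ r' := by
  have e' := congrArg List.reverse e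
  cases h <;> cases h' <;> simp at e'
  case D1.D1 | D2.D2 => simp [e']
  case D3.D3 | D4.D4 => simp [e']
  case I1.I1 | I2.I2 | III1.III1 | III2.III2 => simp [e']
  case I1.I2 =>
    obtain ⟨w, g, hw⟩ := exists_h2_concat (n := n) (hy 0)
    simp [hw] at e'
  case I2.I1 =>
    obtain ⟨w, g, hw⟩ := exists_h2_concat (n := n) (hy 0)
    simp [hw] at e'
  case I1.II1 hi _ => simp [← e'.1] at hi
  case I2.II1 hi _ => simp [← e'.1] at hi
  case II1.I1 hi _ => simp [e'.1] at hi
  case II1.I2 hi _ => simp [e'.1] at hi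
  case II1.II1 =>
    obtain ⟨rfl, e'⟩ := e'
    simpa using e
  case II2.II2 =>
    obtain ⟨rfl, e'⟩ := e'
    simpa using e
  case II1.III1 hi hn => simp [e'.1] at hn
  case III1.II1 hi hn => simp [← e'.1] at hn
  case II2.III2 hi hn => simp [e'.1] at hn
  case III2.II2 hi hn => simp [← e'.1] at hn

lemma _root_.SRule.last_two (hx : ∀ i, x i ≠ []) (hy : ∀ i, y i ≠ []) (h : SRule n x y l r) :
    ∃ m, (∃ g, l = m ++ [l2 g, l3 g]) ∨ (∃ i, l = m ++ [Ltr.B, Ltr.c i]) ∨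
      (∃ g, l = m ++ [l2 g, Ltr.c 0]) ∨ (∃ g i, l = m ++ [l1 g, Ltr.c i]) ∨
      ∃ i, l = m ++ [Ltr.c i, Ltr.B] := by
  cases h
  case D1 g => exact ⟨[_, _], .inl ⟨g, by simp; exact ⟨rfl, rfl⟩⟩⟩
  case D2 g => exact ⟨[_, _], .inl ⟨g, by simp; exact ⟨rfl, rfl⟩⟩⟩
  case D3 g g' => exact ⟨[_, _, _], .inl ⟨g', by simp; exact ⟨rfl, rfl, rfl⟩⟩⟩
  case D4 g g' => exact ⟨[_, _], .inl ⟨g', by simp; exact ⟨rfl, rfl⟩⟩⟩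
  case I1 => exact ⟨_, .inr (.inl ⟨0, rfl⟩)⟩
  case I2 =>
    obtain ⟨w, g, hw⟩ := exists_h2_concat (n := n) (hy 0)
    exact ⟨Ltr.cent2 :: h2 w ++ [l1 g], .inr (.inr (.inl ⟨g, by simp [hw]⟩))⟩
  case II1 i _ _ => exact ⟨_, .inr (.inl ⟨i, rfl⟩)⟩
  case II2 i _ _ => exact ⟨_, .inr (.inr (.inr (.inr ⟨i, rfl⟩)))⟩
  case III1 =>
    obtain ⟨w, g, hw⟩ := exists_h3_concat (n := n) (hx (Fin.last (n + 1)))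
    exact ⟨h3 w, .inr (.inr (.inr (.inl ⟨g, _, by rw [hw]; simp; rfl⟩)))⟩
  case III2 => exact ⟨_, .inr (.inr (.inr (.inr ⟨_, rfl⟩)))⟩

open Classical in
/-- Append a letter to a stack (written with its top at the right end) and apply a rule to
the resulting suffix if there is one. -/
noncomputable def step (x y : Fin (n + 2) → List Γ) (S : List (Ltr n)) (a : Ltr n) :
    List (Ltr n) :=
  if h : ∃ p : List (Ltr n) × List (Ltr n) × List (Ltr n),
      SRule n x y p.1 p.2.1 ∧ S ++ [a] = p.2.2 ++ p.1
  then h.choose.2.2 ++ h.choose.2.1 else S ++ [a]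

/-- Leftmost reduction of a word, starting from a given stack. -/
noncomputable def run (x y : Fin (n + 2) → List Γ) (S W : List (Ltr n)) : List (Ltr n) :=
  W.foldl (step x y) S

@[simp] lemma run_nil (S : List (Ltr n)) : run x y S [] = S := rfl
@[simp] lemma run_cons (S : List (Ltr n)) (a : Ltr n) (W : List (Ltr n)) :
    run x y S (a :: W) = run x y (step x y S a) W := rfl
lemma run_append (S U W : List (Ltr n)) : run x y S (U ++ W) = run x y (run x y S U) W :=
  List.foldl_append

lemma step_of_rule (hy : ∀ i, y i ≠ []) {S P : List (Ltr n)} {a : Ltr n}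
    (h : SRule n x y l r) (e : S ++ [a] = P ++ l) : step x y S a = P ++ r := by
  have hex : ∃ p : List (Ltr n) × List (Ltr n) × List (Ltr n),
      SRule n x y p.1 p.2.1 ∧ S ++ [a] = p.2.2 ++ p.1 := ⟨(l, r, P), h, e⟩
  rw [step, dif_pos hex]
  exact SRule.unique hy hex.choose_spec.1 h (hex.choose_spec.2.symm.trans e)

lemma step_eq_append {S : List (Ltr n)} {a : Ltr n}
    (h : ∀ l r P, SRule n x y l r → S ++ [a] ≠ P ++ l) : step x y S a = S ++ [a] :=
  dif_neg fun ⟨_, hp, e⟩ => h _ _ _ hp e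

lemma step_prefix (S : List (Ltr n)) (a : Ltr n) : step x y S a <+: S ++ [a] := by
  rw [step]
  split_ifs with h
  · obtain ⟨hr, e⟩ := h.choose_spec
    obtain ⟨t, -, ht⟩ := hr.dwindling
    exact ⟨t, (by rw [List.append_assoc, ← ht]; exact e.symm)⟩
  · exact List.prefix_rfl

lemma step_l1 (hx : ∀ i, x i ≠ []) (hy : ∀ i, y i ≠ [])
    (S : List (Ltr n)) (g : Γ) : step x y S (l1 g) = S ++ [l1 g] := by
  refine step_eq_append fun l r P h e => ?_
  have e' := congrArg List.reverse e
  obtain ⟨m, ⟨g, rfl⟩ | ⟨i, rfl⟩ | ⟨g, rfl⟩ | ⟨g, i, rfl⟩ | ⟨i, rfl⟩⟩ := h.last_two hx hy <;>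
    simp at e'

lemma step_l2 (hx : ∀ i, x i ≠ []) (hy : ∀ i, y i ≠ [])
    (S : List (Ltr n)) (g : Γ) : step x y S (l2 g) = S ++ [l2 g] := by
  refine step_eq_append fun l r P h e => ?_
  have e' := congrArg List.reverse e
  obtain ⟨m, ⟨g, rfl⟩ | ⟨i, rfl⟩ | ⟨g, rfl⟩ | ⟨g, i, rfl⟩ | ⟨i, rfl⟩⟩ := h.last_two hx hy <;>
    simp at e'

lemma step_cent (hx : ∀ i, x i ≠ []) (hy : ∀ i, y i ≠ [])
    {z : Ltr n} (hz : z = Ltr.cent1 ∨ z = Ltr.cent2) (S : List (Ltr n)) :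
    step x y S z = S ++ [z] := by
  refine step_eq_append fun l r P h e => ?_
  have e' := congrArg List.reverse e
  obtain ⟨m, ⟨g, rfl⟩ | ⟨i, rfl⟩ | ⟨g, rfl⟩ | ⟨g, i, rfl⟩ | ⟨i, rfl⟩⟩ := h.last_two hx hy <;>
    rcases hz with rfl | rfl <;> simp at e'

lemma step_B (hx : ∀ i, x i ≠ []) (hy : ∀ i, y i ≠ []) (S : List (Ltr n)) (g : Γ) :
    step x y (S ++ [l1 g]) Ltr.B = S ++ [l1 g, Ltr.B] := by
  refine (step_eq_append fun l r P h e => ?_).trans (by simp)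
  have e' := congrArg List.reverse e
  obtain ⟨m, ⟨g, rfl⟩ | ⟨i, rfl⟩ | ⟨g, rfl⟩ | ⟨g, i, rfl⟩ | ⟨i, rfl⟩⟩ := h.last_two hx hy <;>
    simp at e'

lemma step_c (hx : ∀ i, x i ≠ []) (hy : ∀ i, y i ≠ [])
    (S : List (Ltr n)) (g : Γ) {i : Fin (n + 2)} (hi : i ≠ 0) :
    step x y (S ++ [l2 g]) (Ltr.c i) = S ++ [l2 g, Ltr.c i] := by
  refine (step_eq_append fun l r P h e => ?_).trans (by simp)
  have e' := congrArg List.reverse e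
  obtain ⟨m, ⟨g, rfl⟩ | ⟨i, rfl⟩ | ⟨g, rfl⟩ | ⟨g, i, rfl⟩ | ⟨i, rfl⟩⟩ := h.last_two hx hy <;>
    simp at e'
  exact hi e'.1

lemma run_h3 (hx : ∀ i, x i ≠ []) (hy : ∀ i, y i ≠ [])
    (S : List (Ltr n)) (w : List Γ) : run x y S (h3 w) = S ++ h3 w := by
  induction w generalizing S with
  | nil => simp
  | cons g w ih => simp [step_l1 hx hy, ih]

lemma run_h2 (hx : ∀ i, x i ≠ []) (hy : ∀ i, y i ≠ [])
    (S : List (Ltr n)) (w : List Γ) : run x y S (h2 w) = S ++ h2 w := by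
  induction w generalizing S with
  | nil => simp
  | cons g w ih => simp [step_l1 hx hy, step_l2 hx hy, ih]

lemma run_h3_B (hx : ∀ i, x i ≠ []) (hy : ∀ i, y i ≠ [])
    {w : List Γ} (hw : w ≠ []) (S : List (Ltr n)) :
    run x y S (h3 w ++ [Ltr.B]) = S ++ (h3 w ++ [Ltr.B]) := by
  rw [run_append, run_h3 hx hy]
  obtain ⟨w', g, e⟩ := exists_h3_concat (n := n) hw
  rw [e, ← List.append_assoc, run_cons, step_B hx hy]
  simp

lemma run_h2_c (hx : ∀ i, x i ≠ []) (hy : ∀ i, y i ≠ [])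
    {w : List Γ} (hw : w ≠ []) {i : Fin (n + 2)} (hi : i ≠ 0) (S : List (Ltr n)) :
    run x y S (h2 w ++ [Ltr.c i]) = S ++ (h2 w ++ [Ltr.c i]) := by
  rw [run_append, run_h2 hx hy]
  obtain ⟨w', g, e⟩ := exists_h2_concat (n := n) hw
  have e' : S ++ h2 w = (S ++ h2 w' ++ [l1 g]) ++ [l2 g] := by simp [e]
  rw [e', run_cons, step_c hx hy _ _ hi]
  simp [e]

lemma run_rule (hx : ∀ i, x i ≠ []) (hy : ∀ i, y i ≠ [])
    (h : SRule n x y l r) (S : List (Ltr n)) : run x y S l = run x y S r := by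
  have key : ∀ m a, l = m ++ [a] → run x y S m = S ++ m → run x y S r = S ++ r →
      run x y S l = run x y S r := by
    intro m a hl hm hr
    rw [hr, hl, run_append, hm]
    exact step_of_rule hy h (by simp [hl])
  have hc1 (S : List (Ltr n)) : step x y S Ltr.cent1 = S ++ [Ltr.cent1] :=
    step_cent hx hy (.inl rfl) S
  have hc2 (S : List (Ltr n)) : step x y S Ltr.cent2 = S ++ [Ltr.cent2] :=
    step_cent hx hy (.inr rfl) S
  cases h
  case D1 g =>
    exact key [Ltr.cent1, l1 g, l2 g] (l3 g) (by simp) (by simp [hc1, step_l1 hx hy, step_l2 hx hy])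
      (by simp [hc1, step_l1 hx hy])
  case D2 g =>
    exact key [Ltr.cent2, l1 g, l2 g] (l3 g) (by simp) (by simp [hc2, step_l1 hx hy, step_l2 hx hy])
      (by simp [hc2, step_l1 hx hy, step_l2 hx hy])
  case D3 g g' =>
    exact key [l1 g, l2 g, l1 g', l2 g'] (l3 g') (by simp)
      (by simp [step_l1 hx hy, step_l2 hx hy]) (by simp [step_l1 hx hy, step_l2 hx hy])
  case D4 g g' =>
    exact key [l1 g, l1 g', l2 g'] (l3 g') (by simp)
      (by simp [step_l1 hx hy, step_l2 hx hy]) (by simp [step_l1 hx hy])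
  case I1 =>
    exact key (Ltr.cent1 :: (h3 (x 0) ++ [Ltr.B])) (Ltr.c 0) (by simp)
      (by rw [run_cons, hc1, run_h3_B hx hy (hx 0)]; simp) (by simp)
  case I2 =>
    exact key (Ltr.cent2 :: h2 (y 0)) (Ltr.c 0) (by simp)
      (by rw [run_cons, hc2, run_h2 hx hy]; simp) (by simp)
  case II1 i _ _ =>
    exact key (h3 (x i) ++ [Ltr.B]) (Ltr.c i) (by simp) (run_h3_B hx hy (hx i) S) (by simp)
  case II2 i hi _ =>
    exact key (h2 (y i) ++ [Ltr.c i]) Ltr.B (by simp)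
      (run_h2_c hx hy (hy i) (by rintro rfl; simp at hi) S) (by simp)
  case III1 => exact key _ _ rfl (run_h3 hx hy _ _) (by simp)
  case III2 =>
    exact key (h2 (y (Fin.last (n + 1))) ++ [Ltr.c (Fin.last (n + 1))]) Ltr.B (by simp)
      (run_h2_c hx hy (hy _) (Fin.last_pos.ne') S) (by simp)

lemma run_eq_of_cong (hx : ∀ i, x i ≠ []) (hy : ∀ i, y i ≠ [])
    {u v : List (Ltr n)} (h : ThueCong (SSys n x y) u v) (S : List (Ltr n)) :
    run x y S u = run x y S v := by
  induction h with
  | rel u v h =>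
    obtain ⟨p, q, l, r, hr, rfl, rfl⟩ := h
    simp only [run_append]
    rw [run_rule hx hy hr]
  | refl => rfl
  | symm _ _ _ ih => exact ih.symm
  | trans _ _ _ _ _ ih₁ ih₂ => exact ih₁.trans ih₂

/-- Words without a factor that is the left-hand side of a rule. -/
def Irreducible (x y : Fin (n + 2) → List Γ) (W : List (Ltr n)) : Prop :=
  ∀ l r p q, SRule n x y l r → W ≠ p ++ l ++ q

lemma Irreducible.of_append_left {U V : List (Ltr n)} (h : Irreducible x y (U ++ V)) :
    Irreducible x y U := fun l r p q hr e => h l r p (q ++ V) hr (by simp [e])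

lemma Irreducible.of_append_right {U V : List (Ltr n)} (h : Irreducible x y (U ++ V)) :
    Irreducible x y V := fun l r p q hr e => h l r (U ++ p) q hr (by simp [e])

/-- Reading an irreducible word either leaves it on the stack, or the first reduction
straddles the boundary between the initial stack and the word. -/
lemma run_dichotomy (hy : ∀ i, y i ≠ []) (S : List (Ltr n))
    {R : List (Ltr n)} (hR : Irreducible x y R) :
    run x y S R = S ++ R ∨ ∃ P A T R' l r, SRule n x y l r ∧ A ≠ [] ∧ T ≠ [] ∧ S = P ++ A ∧
      l = A ++ T ∧ R = T ++ R' ∧ run x y S R = run x y (P ++ r) R' := by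
  induction R using List.reverseRecOn with
  | nil => simp
  | append_singleton R a ih =>
    rcases ih hR.of_append_left with h | ⟨P, A, T, R', l, r, h, hA, hT, hS, hl, rfl, e⟩
    · by_cases hex : ∃ l r P, SRule n x y l r ∧ S ++ R ++ [a] = P ++ l
      · obtain ⟨l, r, P, hr, e⟩ := hex
        right
        have hrun : run x y S (R ++ [a]) = P ++ r := by
          rw [run_append, h]
          exact step_of_rule hy hr e
        rw [List.append_assoc, List.append_eq_append_iff] at e
        rcases e with ⟨A, rfl, e⟩ | ⟨A, rfl, e⟩
        · exact absurd (by simpa using e) (hR l r A [] hr)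
        · refine ⟨P, A, R ++ [a], [], l, r, hr, ?_, by simp, rfl, e, by simp, hrun⟩
          rintro rfl
          exact hR l r [] [] hr (by simpa using e.symm)
      · push Not at hex
        left
        rw [run_append, h, run_cons, step_eq_append hex]
        simp
    · right
      refine ⟨P, A, T, R' ++ [a], l, r, h, hA, hT, hS, hl, by simp, ?_⟩
      rw [run_append, e, run_append]

/-- The possible beginnings of an irreducible word that erases a stack `¢₁ h₃(u)`. -/
lemma erase_cent1 (hx : ∀ i, x i ≠ []) (hy : ∀ i, y i ≠ []) {u : List Γ} {R : List (Ltr n)}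
    (hR : Irreducible x y R) (h : run x y (Ltr.cent1 :: h3 u) R = []) :
    (∃ g R', R = l1 g :: l2 g :: l3 g :: R' ∧ run x y (Ltr.cent1 :: h3 (u ++ [g])) R' = []) ∨
    (∃ g R', R = l2 g :: R') ∨
    (∃ g z R', R = l1 g :: z :: R' ∧ ∀ g', z ≠ l2 g') ∨
    (∃ u' R', u = u' ++ x (Fin.last (n + 1)) ∧ R = Ltr.c (Fin.last (n + 1)) :: R' ∧
      run x y (Ltr.cent1 :: h3 u') R' = []) ∨
    (∃ (i : Fin (n + 2)) (u' : List Γ) (R' : List (Ltr n)), 1 ≤ (i : ℕ) ∧ (i : ℕ) ≤ n ∧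
      u = u' ++ x i ∧ R = Ltr.B :: Ltr.c i :: R' ∧ run x y (Ltr.cent1 :: h3 u') R' = []) ∨
    (∃ R', R = Ltr.B :: Ltr.c 0 :: R' ∧ u = x 0) := by
  rcases run_dichotomy hy (Ltr.cent1 :: h3 u) hR with
    h' | ⟨P, A, T, R', l, r, hr, hA, -, hS₀, hl, rfl, e⟩
  · simp [h'] at h
  rw [e] at h
  clear e hR
  obtain ⟨A, e, rfl⟩ := (List.eq_nil_or_concat' A).resolve_left hA
  replace hl : l = A ++ e :: T := by simpa using hl
  rcases List.eq_nil_or_concat' u with rfl | ⟨u, g, rfl⟩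
  · obtain ⟨rfl, rfl, rfl⟩ : P = [] ∧ A = [] ∧ e = Ltr.cent1 := by
      simpa [List.cons_eq_append_iff, List.append_eq_cons_iff] using hS₀
    cases hr
    case D1 g =>
      simp at hl
      subst hl
      exact .inl ⟨g, R', by simp, by simpa using h⟩
    case I1 =>
      obtain ⟨g, w, hw⟩ := List.exists_cons_of_ne_nil (hx 0)
      simp [hw] at hl
      subst hl
      right; right; left
      cases w with
      | nil => exact ⟨g, Ltr.B, _, by simp; rfl, by simp⟩
      | cons g' w => exact ⟨g, l1 g', _, by simp; rfl, by simp⟩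
    case D2 | D3 | D4 | I2 => simp at hl
    case II1 i _ _ =>
      obtain ⟨g, w, hw⟩ := List.exists_cons_of_ne_nil (hx i)
      simp [hw] at hl
    case II2 i _ _ =>
      obtain ⟨g, w, hw⟩ := List.exists_cons_of_ne_nil (hy i)
      simp [hw] at hl
    case III1 =>
      obtain ⟨g, w, hw⟩ := List.exists_cons_of_ne_nil (hx (Fin.last (n + 1)))
      simp [hw] at hl
    case III2 =>
      obtain ⟨g, w, hw⟩ := List.exists_cons_of_ne_nil (hy (Fin.last (n + 1)))
      simp [hw] at hl
  · obtain ⟨hS, rfl⟩ : Ltr.cent1 :: h3 u = P ++ A ∧ e = l1 g := by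
      have := List.append_inj' (s₁ := Ltr.cent1 :: h3 u) (t₁ := [l1 g]) (s₂ := P ++ A)
        (t₂ := [e]) (by simpa using hS₀) rfl
      simpa [eq_comm] using this
    clear hS₀
    have of_l2 {A X : List (Ltr n)} {w : List Γ} (hX : ∀ g, l1 g ∉ X)
        (hl : h2 w ++ X = A ++ l1 g :: T) : ∃ g R₀, T ++ R' = l2 g :: R₀ := by
      obtain ⟨T', rfl⟩ := h2_split_l1 hX hl
      exact ⟨g, _, rfl⟩
    have of_h3 {q : List Γ} {z : Ltr n} {X : List (Ltr n)} (hq : q ≠ []) (hz : IsMarker z)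
        (hT : T = h3 q ++ z :: X) : ∃ g z R₀, T ++ R' = l1 g :: z :: R₀ ∧ ∀ g', z ≠ l2 g' := by
      subst hT
      match q, hq with
      | [g], _ => exact ⟨g, z, _, by simp; rfl, fun g' => (hz g').2.1⟩
      | g :: g' :: q, _ => exact ⟨g, l1 g', _, by simp; rfl, by simp⟩
    cases hr
    case D1 g' =>
      cases A with
      | nil => simp at hl
      | cons z A => exact .inr (.inl (of_l2 (A := A) (w := [g']) (X := [l3 g']) (by simp)
        (by simp at hl; simpa using hl.2)))
    case D2 g' =>
      cases A with
      | nil => simp at hl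
      | cons z A => exact .inr (.inl (of_l2 (A := A) (w := [g']) (X := [l3 g']) (by simp)
        (by simp at hl; simpa using hl.2)))
    case D3 g₁ g₂ =>
      exact .inr (.inl (of_l2 (w := [g₁, g₂]) (X := [l3 g₂]) (by simp) (by simpa using hl)))
    case D4 g₁ g₂ =>
      cases A with
      | nil =>
        obtain ⟨rfl, rfl⟩ : g₁ = g ∧ [l1 g₂, l2 g₂, l3 g₂] = T := by simpa using hl
        refine .inl ⟨g₂, R', rfl, ?_⟩
        obtain rfl : Ltr.cent1 :: h3 u = P := by simpa using hS
        simpa using h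
      | cons z A => exact .inr (.inl (of_l2 (A := A) (w := [g₂]) (X := [l3 g₂]) (by simp)
        (by simp at hl; simpa using hl.2)))
    case I1 =>
      cases A with
      | nil => simp at hl
      | cons z A =>
        have hl' : h3 (x 0) ++ [Ltr.B, Ltr.c 0] = A ++ l1 g :: T := by simp at hl; exact hl.2
        obtain ⟨p, q, hw, rfl, rfl⟩ := h3_split (by simp) hl'
        by_cases hq : q = []
        · subst hq
          obtain ⟨rfl, rfl⟩ : Ltr.cent1 = z ∧ P = [] := by
            refine ⟨by simp at hl; exact hl.1, ?_⟩
            cases P with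
            | nil => rfl
            | cons z' P =>
              have : z ∈ h3 u := by simp at hS; simp [hS]
              simp at hl
              simp [← hl.1] at this
          have hu : u = p := by simpa [h3_inj] using hS
          simp [hw, hu]
        · exact .inr (.inr (.inl (of_h3 hq isMarker_B rfl)))
    case I2 =>
      cases A with
      | nil => simp at hl
      | cons z A =>
        exact .inr (.inl (of_l2 (w := y 0) (X := [Ltr.c 0]) (by simp) (by simp at hl; exact hl.2)))
    case II1 i hi hn =>
      obtain ⟨p, q, hw, rfl, rfl⟩ := h3_split (by simp) hl
      by_cases hq : q = []
      · obtain ⟨u', rfl, rfl⟩ := suffix_h3 hS.symm (by simp)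
        exact .inr (.inr (.inr (.inr (.inl
          ⟨i, u', R', hi, hn, by simp [hw, hq], by simp [hq], by simpa using h⟩))))
      · exact .inr (.inr (.inl (of_h3 hq isMarker_B rfl)))
    case III1 =>
      obtain ⟨p, q, hw, rfl, rfl⟩ := h3_split (by simp) hl
      by_cases hq : q = []
      · obtain ⟨u', rfl, rfl⟩ := suffix_h3 hS.symm (by simp)
        exact .inr (.inr (.inr (.inl
          ⟨u', R', by simp [hw, hq], by simp [hq], by simpa using h⟩)))
      · exact .inr (.inr (.inl (of_h3 hq (isMarker_c _) rfl)))
    case II2 => exact .inr (.inl (of_l2 (by simp) hl))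
    case III2 => exact .inr (.inl (of_l2 (by simp) hl))

/-- The possible beginnings of an irreducible word that erases a stack `¢₂ h₂(u)`. -/
lemma erase_cent2 (hx : ∀ i, x i ≠ []) (hy : ∀ i, y i ≠ []) {u : List Γ} {R : List (Ltr n)}
    (hR : Irreducible x y R) (h : run x y (Ltr.cent2 :: h2 u) R = []) :
    (∃ g R', R = l1 g :: l2 g :: l3 g :: R' ∧ run x y (Ltr.cent2 :: h2 (u ++ [g])) R' = []) ∨
    (∃ g R', R = l3 g :: R') ∨
    (∃ g z R', R = l1 g :: l2 g :: z :: R' ∧ ∀ g', z ≠ l3 g') ∨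
    (∃ (i : Fin (n + 2)) (u' : List Γ) (R' : List (Ltr n)), i ≠ 0 ∧
      u = u' ++ y i ∧ R = Ltr.c i :: Ltr.B :: R' ∧ run x y (Ltr.cent2 :: h2 u') R' = []) ∨
    (∃ R', R = Ltr.c 0 :: R' ∧ u = y 0) := by
  rcases run_dichotomy hy (Ltr.cent2 :: h2 u) hR with
    h' | ⟨P, A, T, R', l, r, hr, hA, -, hS₀, hl, rfl, e⟩
  · simp [h'] at h
  rw [e] at h
  clear e hR
  obtain ⟨A, e, rfl⟩ := (List.eq_nil_or_concat' A).resolve_left hA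
  replace hl : l = A ++ e :: T := by simpa using hl
  have of_h2 {q : List Γ} {z : Ltr n} {X : List (Ltr n)} (hq : q ≠ []) (hz : IsMarker z)
      (hT : T = h2 q ++ z :: X) :
      ∃ g z R₀, T ++ R' = l1 g :: l2 g :: z :: R₀ ∧ ∀ g', z ≠ l3 g' := by
    subst hT
    match q, hq with
    | [g], _ => exact ⟨g, z, _, by simp; rfl, fun g' => (hz g').2.2⟩
    | g :: g' :: q, _ => exact ⟨g, l1 g', _, by simp; rfl, by simp⟩
  rcases List.eq_nil_or_concat' u with rfl | ⟨u, g, rfl⟩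
  · obtain ⟨rfl, rfl, rfl⟩ : P = [] ∧ A = [] ∧ e = Ltr.cent2 := by
      simpa [List.cons_eq_append_iff, List.append_eq_cons_iff] using hS₀
    cases hr
    case D2 g =>
      simp at hl
      subst hl
      exact .inl ⟨g, R', by simp, by simpa using h⟩
    case I2 =>
      exact .inr (.inr (.inl (of_h2 (hy 0) (isMarker_c 0) (by simp at hl; exact hl.symm))))
    case D1 | D3 | D4 | I1 => simp at hl
    case II1 i _ _ =>
      obtain ⟨g, w, hw⟩ := List.exists_cons_of_ne_nil (hx i)
      simp [hw] at hl
    case II2 i _ _ =>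
      obtain ⟨g, w, hw⟩ := List.exists_cons_of_ne_nil (hy i)
      simp [hw] at hl
    case III1 =>
      obtain ⟨g, w, hw⟩ := List.exists_cons_of_ne_nil (hx (Fin.last (n + 1)))
      simp [hw] at hl
    case III2 =>
      obtain ⟨g, w, hw⟩ := List.exists_cons_of_ne_nil (hy (Fin.last (n + 1)))
      simp [hw] at hl
  · obtain ⟨hS, rfl⟩ : Ltr.cent2 :: (h2 u ++ [l1 g]) = P ++ A ∧ e = l2 g := by
      have := List.append_inj' (s₁ := Ltr.cent2 :: (h2 u ++ [l1 g])) (t₁ := [l2 g])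
        (s₂ := P ++ A) (t₂ := [e]) (by simpa using hS₀) rfl
      simpa [eq_comm] using this
    clear hS₀
    have of_l3 {A : List (Ltr n)} {g' : Γ}
        (hl : [l1 g', l2 g', l3 g'] = A ++ l2 g :: T) : ∃ g R₀, T ++ R' = l3 g :: R₀ := by
      obtain ⟨p, q, hpq, rfl, rfl⟩ := h2_split_l2 (w := [g']) (Z := [l3 g']) (by simp)
        (by simpa using hl)
      obtain rfl : q = [] := by
        have := congrArg List.length hpq
        simp at this
        exact List.length_eq_zero_iff.mp (by omega)
      exact ⟨g', R', rfl⟩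
    have pop {p : List Γ} (hS : Ltr.cent2 :: (h2 u ++ [l1 g]) = P ++ (h2 p ++ [l1 g])) :
        ∃ u', u = u' ++ p ∧ P = Ltr.cent2 :: h2 u' :=
      suffix_h2 (List.append_cancel_right (bs := [l1 g]) (by simpa using hS.symm))
    cases hr
    case D1 g' | D2 g' =>
      cases A with
      | nil => simp at hl
      | cons z A => exact .inr (.inl (of_l3 (A := A) (g' := g') (by simp at hl; exact hl.2)))
    case D3 g₁ g₂ =>
      match A with
      | [] => simp at hl
      | [z] =>
        simp at hl
        obtain ⟨rfl, rfl, rfl⟩ := hl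
        obtain ⟨u', rfl, rfl⟩ := pop (p := []) (by simpa using hS)
        exact .inl ⟨g₂, R', rfl, by simpa using h⟩
      | z :: z' :: A => exact .inr (.inl (of_l3 (A := A) (by simp at hl; exact hl.2.2)))
    case D4 g₁ g₂ =>
      cases A with
      | nil => simp at hl
      | cons z A => exact .inr (.inl (of_l3 (A := A) (by simp at hl; exact hl.2)))
    case I1 =>
      have : (l2 g : Ltr n) ∈ [Ltr.cent1] ++ h3 (x 0) ++ [Ltr.B, Ltr.c 0] := by rw [hl]; simp
      simp at this
    case II1 i _ _ =>
      have : (l2 g : Ltr n) ∈ h3 (x i) ++ [Ltr.B, Ltr.c i] := by rw [hl]; simp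
      simp at this
    case III1 =>
      have : (l2 g : Ltr n) ∈ h3 (x (Fin.last (n + 1))) ++ [Ltr.c (Fin.last (n + 1))] := by
        rw [hl]; simp
      simp at this
    case I2 =>
      cases A with
      | nil => simp at hl
      | cons z A =>
        have hl' : h2 (y 0) ++ [Ltr.c 0] = A ++ l2 g :: T := by simp at hl; exact hl.2
        obtain ⟨p, q, hw, rfl, rfl⟩ := h2_split_l2 (by simp) hl'
        by_cases hq : q = []
        · subst hq
          obtain ⟨rfl, rfl⟩ : Ltr.cent2 = z ∧ P = [] := by
            refine ⟨by simp at hl; exact hl.1, ?_⟩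
            cases P with
            | nil => rfl
            | cons z' P =>
              have : z ∈ h2 u ++ [l1 g] := by simp at hS; simp [hS]
              simp at hl
              simp [← hl.1] at this
          have hu : u = p := by simpa [h2_inj] using hS
          simp [hw, hu]
        · exact .inr (.inr (.inl (of_h2 hq (isMarker_c 0) rfl)))
    case II2 i hi _ =>
      obtain ⟨p, q, hw, rfl, rfl⟩ := h2_split_l2 (by simp) hl
      by_cases hq : q = []
      · obtain ⟨u', rfl, rfl⟩ := pop hS
        exact .inr (.inr (.inr (.inl ⟨i, u', R', by rintro rfl; simp at hi, by simp [hw, hq],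
          by simp [hq], by simpa using h⟩)))
      · exact .inr (.inr (.inl (of_h2 hq (isMarker_c _) rfl)))
    case III2 =>
      obtain ⟨p, q, hw, rfl, rfl⟩ := h2_split_l2 (by simp) hl
      by_cases hq : q = []
      · obtain ⟨u', rfl, rfl⟩ := pop hS
        exact .inr (.inr (.inr (.inl ⟨_, u', R', Fin.last_pos.ne', by simp [hw, hq],
          by simp [hq], by simpa using h⟩)))
      · exact .inr (.inr (.inl (of_h2 hq (isMarker_c _) rfl)))

/-- The two reductions that pop dominoes from the two stacks use the same index sequence. -/
lemma exists_indices (hx : ∀ i, x i ≠ []) (hy : ∀ i, y i ≠ []) (R : List (Ltr n))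
    (u₁ u₂ : List Γ) (hR : Irreducible x y (Ltr.B :: R))
    (h₁ : run x y (Ltr.cent1 :: h3 u₁) (Ltr.B :: R) = [])
    (h₂ : run x y (Ltr.cent2 :: h2 u₂) R = []) :
    ∃ L : List (Fin (n + 2)), (∀ i ∈ L, 1 ≤ (i : ℕ) ∧ (i : ℕ) ≤ n) ∧
      u₁ = x 0 ++ L.flatMap x ∧ u₂ = y 0 ++ L.flatMap y := by
  have hR₂ : Irreducible x y R := hR.of_append_right (U := [Ltr.B])
  rcases erase_cent2 hx hy hR₂ h₂ with ⟨g, R', rfl, -⟩ | ⟨g, R', rfl⟩ | ⟨g, z, R', rfl, -⟩ |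
    ⟨i, v₂, R', hi, rfl, rfl, h₂'⟩ | ⟨R', rfl, rfl⟩ <;>
  rcases erase_cent1 hx hy hR h₁ with ⟨g', R'', e, -⟩ | ⟨g', R'', e⟩ | ⟨g', z', R'', e, -⟩ |
    ⟨v₁, R'', -, e, -⟩ | ⟨j, v₁, R'', hj, hn, rfl, e, h₁'⟩ | ⟨R'', e, rfl⟩ <;>
  simp at e
  · obtain ⟨rfl, rfl⟩ := e
    obtain ⟨L, hL, rfl, rfl⟩ := exists_indices hx hy R' v₁ v₂
      (hR₂.of_append_right (U := [Ltr.c i])) h₁' h₂'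
    refine ⟨L ++ [i], fun k hk => ?_, by simp, by simp⟩
    rcases List.mem_append.mp hk with hk | hk
    · exact hL k hk
    · rw [List.mem_singleton.mp hk]; exact ⟨hj, hn⟩
  · exact absurd e.1 hi
  · simp [← e.1] at hj
  · exact ⟨[], by simp, by simp, by simp⟩
termination_by R.length
decreasing_by subst R; simp

/-- A word erasing both stacks yields a solution. -/
lemma solvable_of_run_eq_nil (hx : ∀ i, x i ≠ []) (hy : ∀ i, y i ≠ []) (R : List (Ltr n))
    (u : List Γ) (hR : Irreducible x y R)
    (h₁ : run x y (Ltr.cent1 :: h3 u) R = []) (h₂ : run x y (Ltr.cent2 :: h2 u) R = []) :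
    GPCPSolvable n x y := by
  rcases erase_cent2 hx hy hR h₂ with ⟨g, R', rfl, h₂'⟩ | ⟨g, R', rfl⟩ | ⟨g, z, R', rfl, hz⟩ |
    ⟨i, v₂, R', hi, hu, rfl, h₂'⟩ | ⟨R', rfl, hu⟩ <;>
  rcases erase_cent1 hx hy hR h₁ with ⟨g', R'', e, h₁'⟩ | ⟨g', R'', e⟩ | ⟨g', z', R'', e, hz'⟩ |
    ⟨v₁, R'', hu', e, h₁'⟩ | ⟨j, v₁, R'', hj, hn, hu', e, h₁'⟩ | ⟨R'', e, hu'⟩ <;>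
  simp at e
  · obtain ⟨rfl, rfl⟩ := e
    exact solvable_of_run_eq_nil hx hy R' (u ++ [g])
      (hR.of_append_right (U := [l1 g, l2 g, l3 g])) h₁' h₂'
  · exact absurd e.2.1.symm (hz' g)
  · exact absurd e.2.1 (hz g')
  · exact absurd e.2.1.symm (hz' g)
  · obtain ⟨rfl, rfl⟩ := e
    obtain ⟨L, hL, rfl, rfl⟩ := exists_indices hx hy R' v₁ v₂
      (hR.of_append_right (U := [Ltr.c (Fin.last (n + 1))])) h₁' h₂'
    exact ⟨L, hL, hu'.symm.trans hu⟩
termination_by R.length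
decreasing_by subst R; simp; omega

/-- The bottom letter of a stack is only removed by emptying the stack. -/
lemma run_cons_bottom (e : Ltr n) (S Q : List (Ltr n)) :
    (∃ S', run x y (e :: S) Q = e :: S') ∨
      ∃ Q₁ Q₂, Q = Q₁ ++ Q₂ ∧ run x y (e :: S) Q₁ = [] := by
  induction Q using List.reverseRecOn with
  | nil => exact .inl ⟨S, rfl⟩
  | append_singleton Q a ih =>
    rcases ih with ⟨S', h⟩ | ⟨Q₁, Q₂, rfl, h⟩
    · have hp := step_prefix (x := x) (y := y) (e :: S') a
      rw [List.cons_append, List.prefix_cons_iff] at hp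
      have hr : run x y (e :: S) (Q ++ [a]) = step x y (e :: S') a := by
        rw [run_append, h, run_cons, run_nil]
      rcases hp with hp | ⟨S'', hp, -⟩
      · exact .inr ⟨Q ++ [a], [], by simp, hr.trans hp⟩
      · exact .inl ⟨S'', hr.trans hp⟩
    · exact .inr ⟨Q₁, Q₂ ++ [a], by simp, h⟩

lemma run_of_irreducible (hy : ∀ i, y i ≠ []) {V : List (Ltr n)} (hV : Irreducible x y V) :
    run x y [] V = V := by
  rcases run_dichotomy hy [] hV with h | ⟨P, A, T, R', l, r, -, hA, -, hS, -⟩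
  · simpa using h
  · simp at hS
    exact absurd hS.2 hA

lemma run_cent_of_irreducible (hy : ∀ i, y i ≠ []) {e : Ltr n}
    (he : e = Ltr.cent1 ∨ e = Ltr.cent2) {V : List (Ltr n)} (hV : Irreducible x y (e :: V))
    (S : List (Ltr n)) : run x y S (e :: V) = S ++ e :: V := by
  rcases run_dichotomy hy S hV with h | ⟨P, A, T, R', l, r, hr, hA, hT, -, hl, hR, -⟩
  · exact h
  · obtain ⟨z, T, rfl⟩ := List.exists_cons_of_ne_nil hT
    obtain ⟨rfl, -⟩ : e = z ∧ _ := by simpa using hR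
    exact absurd (hr.not_cent_mem he hl) hA

lemma run_eq_nil_of_alive (hy : ∀ i, y i ≠ []) {e e' : Ltr n}
    (he : e = Ltr.cent1 ∨ e = Ltr.cent2) {Q V S : List (Ltr n)} (hV : Irreducible x y V)
    (h : run x y [e] (Q ++ V) = e :: S) (h' : run x y [e'] Q = [])
    (hrun : run x y [e] (Q ++ V) = run x y [e'] (Q ++ V)) : run x y [e] Q = [] := by
  obtain rfl : V = e :: S := by
    rw [← h, hrun, run_append, h', run_of_irreducible hy hV]
  rw [run_append, run_cent_of_irreducible hy he hV] at h
  simpa using h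

lemma cong_of_rule (h : SRule n x y l r) (p q : List (Ltr n)) :
    ThueCong (SSys n x y) (p ++ l ++ q) (p ++ r ++ q) :=
  .rel _ _ ⟨p, q, l, r, h, rfl, rfl⟩

lemma _root_.ThueCong.trans {α : Type*} {R : Set (List α × List α)} {u v w : List α}
    (h : ThueCong R u v) (h' : ThueCong R v w) : ThueCong R u w := Relation.EqvGen.trans _ _ _ h h'

lemma _root_.ThueCong.symm {α : Type*} {R : Set (List α × List α)} {u v : List α}
    (h : ThueCong R u v) : ThueCong R v u := Relation.EqvGen.symm _ _ h

lemma solvable_of_cong (hx : ∀ i, x i ≠ []) (hy : ∀ i, y i ≠ []) (W : List (Ltr n))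
    (h : ThueCong (SSys n x y) (Ltr.cent1 :: W) (Ltr.cent2 :: W)) : GPCPSolvable n x y := by
  by_cases hW : Irreducible x y W
  · have hrun : run x y [Ltr.cent1] W = run x y [Ltr.cent2] W := by
      simpa [step_cent hx hy] using run_eq_of_cong hx hy h []
    rcases run_cons_bottom (x := x) (y := y) Ltr.cent1 [] W with
      ⟨S₁, h₁⟩ | ⟨Q₁, V₁, e₁, h₁⟩ <;>
    rcases run_cons_bottom (x := x) (y := y) Ltr.cent2 [] W with
      ⟨S₂, h₂⟩ | ⟨Q₂, V₂, e₂, h₂⟩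
    · simp [h₁, h₂] at hrun
    · subst e₂
      exact solvable_of_run_eq_nil hx hy Q₂ [] hW.of_append_left
        (run_eq_nil_of_alive hy (.inl rfl) hW.of_append_right h₁ h₂ hrun) h₂
    · subst e₁
      exact solvable_of_run_eq_nil hx hy Q₁ [] hW.of_append_left h₁
        (run_eq_nil_of_alive hy (.inr rfl) hW.of_append_right h₂ h₁ hrun.symm)
    · have hV₁ := run_of_irreducible hy (e₁ ▸ hW).of_append_right
      have hV₂ := run_of_irreducible hy (e₂ ▸ hW).of_append_right
      have hV : V₁ = V₂ := by
        calc V₁ = run x y [Ltr.cent1] (Q₁ ++ V₁) := by rw [run_append, h₁, hV₁]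
          _ = run x y [Ltr.cent2] (Q₂ ++ V₂) := by rw [← e₁, ← e₂, hrun]
          _ = V₂ := by rw [run_append, h₂, hV₂]
      subst hV
      obtain rfl : Q₁ = Q₂ := List.append_cancel_right (e₁.symm.trans e₂)
      exact solvable_of_run_eq_nil hx hy Q₁ [] (e₁ ▸ hW).of_append_left h₁ h₂
  · simp only [Irreducible, not_forall, not_not] at hW
    obtain ⟨l, r, p, q, hr, rfl⟩ := hW
    have hlt : (p ++ r ++ q).length < (p ++ l ++ q).length := by
      obtain ⟨t, ht, rfl⟩ := hr.dwindling
      have := List.length_pos_iff.mpr ht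
      simp; omega
    have hc (e : Ltr n) : ThueCong (SSys n x y) (e :: (p ++ l ++ q)) (e :: (p ++ r ++ q)) :=
      cong_of_rule hr (e :: p) q
    exact solvable_of_cong hx hy (p ++ r ++ q) (((hc _).symm.trans h).trans (hc _))
termination_by W.length
decreasing_by subst W; exact hlt

lemma cong_cent1_h1 (u w : List Γ) (Z : List (Ltr n)) :
    ThueCong (SSys n x y) (Ltr.cent1 :: h3 u ++ h1 w ++ Z) (Ltr.cent1 :: h3 (u ++ w) ++ Z) := by
  induction w generalizing u with
  | nil => simpa using .refl _
  | cons g w ih =>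
    refine .trans (v := Ltr.cent1 :: h3 (u ++ [g]) ++ h1 w ++ Z) ?_ (by simpa using ih (u ++ [g]))
    rcases List.eq_nil_or_concat' u with rfl | ⟨u, g', rfl⟩
    · simpa using cong_of_rule (.D1 (x := x) (y := y) g) [] (h1 w ++ Z)
    · simpa using cong_of_rule (.D4 (x := x) (y := y) g' g) (Ltr.cent1 :: h3 u) (h1 w ++ Z)

lemma cong_cent2_h1 (u w : List Γ) (Z : List (Ltr n)) :
    ThueCong (SSys n x y) (Ltr.cent2 :: h2 u ++ h1 w ++ Z) (Ltr.cent2 :: h2 (u ++ w) ++ Z) := by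
  induction w generalizing u with
  | nil => simpa using .refl _
  | cons g w ih =>
    refine .trans (v := Ltr.cent2 :: h2 (u ++ [g]) ++ h1 w ++ Z) ?_ (by simpa using ih (u ++ [g]))
    rcases List.eq_nil_or_concat' u with rfl | ⟨u, g', rfl⟩
    · simpa using cong_of_rule (.D2 (x := x) (y := y) g) [] (h1 w ++ Z)
    · simpa using cong_of_rule (.D3 (x := x) (y := y) g' g) (Ltr.cent2 :: h2 u) (h1 w ++ Z)

/-- The word that pops the dominoes of a reversed index sequence, followed by domino `0`. -/
def popWord : List (Fin (n + 2)) → List (Ltr n)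
  | [] => [Ltr.c 0]
  | i :: M => Ltr.c i :: Ltr.B :: popWord M

lemma cong_cent1_popWord (M : List (Fin (n + 2))) (hM : ∀ i ∈ M, 1 ≤ (i : ℕ) ∧ (i : ℕ) ≤ n) :
    ThueCong (SSys n x y)
      (Ltr.cent1 :: h3 (x 0 ++ M.reverse.flatMap x) ++ Ltr.B :: popWord M) [] := by
  induction M with
  | nil => simpa [popWord] using cong_of_rule (.I1 (x := x) (y := y)) [] []
  | cons i M ih =>
    obtain ⟨⟨hi, hn⟩, hM⟩ := List.forall_mem_cons.mp hM
    refine .trans ?_ (ih hM)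
    simpa [popWord] using cong_of_rule (.II1 (x := x) (y := y) i hi hn)
      (Ltr.cent1 :: h3 (x 0 ++ M.reverse.flatMap x)) (Ltr.B :: popWord M)

lemma cong_cent2_popWord (M : List (Fin (n + 2))) (hM : ∀ i ∈ M, 1 ≤ (i : ℕ) ∧ (i : ℕ) ≤ n) :
    ThueCong (SSys n x y)
      (Ltr.cent2 :: h2 (y 0 ++ M.reverse.flatMap y) ++ popWord M) [] := by
  induction M with
  | nil => simpa [popWord] using cong_of_rule (.I2 (x := x) (y := y)) [] []
  | cons i M ih =>
    obtain ⟨⟨hi, hn⟩, hM⟩ := List.forall_mem_cons.mp hM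
    refine .trans ?_ (ih hM)
    simpa [popWord] using cong_of_rule (.II2 (x := x) (y := y) i hi hn)
      (Ltr.cent2 :: h2 (y 0 ++ M.reverse.flatMap y)) (popWord M)

lemma exists_cong_of_solvable (h : GPCPSolvable n x y) :
    ∃ W : List (Ltr n), ThueCong (SSys n x y) (Ltr.cent1 :: W) (Ltr.cent2 :: W) := by
  obtain ⟨L, hL, hw⟩ := h
  have hM : ∀ i ∈ L.reverse, 1 ≤ (i : ℕ) ∧ (i : ℕ) ≤ n := by simpa using hL
  refine ⟨h1 (x 0 ++ L.flatMap x ++ x (Fin.last (n + 1))) ++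
    Ltr.c (Fin.last (n + 1)) :: Ltr.B :: popWord L.reverse, .trans (v := []) ?_ (.symm ?_)⟩
  · refine .trans (cong_cent1_h1 [] _ _) (.trans ?_ (cong_cent1_popWord _ hM))
    simpa using cong_of_rule (.III1 (x := x) (y := y))
      (Ltr.cent1 :: h3 (x 0 ++ L.flatMap x)) (Ltr.B :: popWord L.reverse)
  · rw [hw]
    refine .trans (cong_cent2_h1 [] _ _) (.trans ?_ (cong_cent2_popWord _ hM))
    simpa using cong_of_rule (.III2 (x := x) (y := y))
      (Ltr.cent2 :: h2 (y 0 ++ L.flatMap y)) (popWord L.reverse)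

end Rules

end CommonTerm

/-- There exists `W ∈ Σ̂*` with `¢₁ W ↔*_S ¢₂ W` iff the GPCP instance has a
solution (correctness of the reduction for the Common Term problem). -/
theorem ct_reduction_correct (n : ℕ) (x y : Fin (n + 2) → List Γ)
    (hx : ∀ i, x i ≠ []) (hy : ∀ i, y i ≠ []) :
    (∃ W : List (Ltr n), ThueCong (SSys n x y) (Ltr.cent1 :: W) (Ltr.cent2 :: W)) ↔
      GPCPSolvable n x y := by
  exact ⟨fun ⟨W, h⟩ => CommonTerm.solvable_of_cong hx hy W h, CommonTerm.exists_cong_of_solvable⟩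
end

section
/- Let S be the string rewriting system constructed from a given GPCP instance as described. Then S is terminating: there is no infinite sequence of strings u_0 →_S u_1 →_S u_2 →_S ⋯ (equivalently, the converse of the one-step rewrite relation →_S is well-founded). -/
/-- Every rule of `S` is strictly length-decreasing. -/
theorem SRule.length_lt {n : ℕ} {x y : Fin (n + 2) → List Γ} {l r : List (Ltr n)}
    (h : SRule n x y l r) : r.length < l.length := by
  cases h with
  | D1 g => cases g <;> simp [h1, h3]
  | D2 g => cases g <;> simp [h1, h2]
  | D3 g g' => cases g' <;> simp [h1, h2]
  | D4 g g' => cases g' <;> simp [h1, h3]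
  | _ => simp

/-- The system `S` is terminating: there is no infinite rewrite sequence,
i.e. the converse of the one-step rewrite relation is well-founded. -/
theorem S_terminating (n : ℕ) (x y : Fin (n + 2) → List Γ)
    (hx : ∀ i, x i ≠ []) (hy : ∀ i, y i ≠ []) :
    WellFounded (fun u v : List (Ltr n) => OneStep (SSys n x y) v u) := by
  refine Subrelation.wf ?_ (measure (List.length (α := Ltr n))).wf
  rintro u v ⟨p, q, l, r, h, rfl, rfl⟩
  have hlt : r.length < l.length := SRule.length_lt h
  change (p ++ r ++ q).length < (p ++ l ++ q).length
  simpa using hlt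
end

section
/- Let S be the string rewriting system constructed from a given GPCP instance as described. Then for every string w ∈ Γ*, the Class D rules yield ¢_1 h_1(w) →*_S ¢_1 h_3(w) and ¢_2 h_1(w) →*_S ¢_2 h_2(w). -/
theorem OneStep.of_mem {α : Type*} {R : Set (List α × List α)} {l r : List α}
    (h : (l, r) ∈ R) (u v : List α) : OneStep R (u ++ l ++ v) (u ++ r ++ v) :=
  ⟨u, v, l, r, h, rfl, rfl⟩

/-- If every rule `e g f g' → e g e g'` is in `R`, then a block `e g` sweeps rightwards through
a word coded by `f`, recoding it by `e`. -/
theorem RewStar.sweep {α β : Type*} {R : Set (List α × List α)} {e f : β → List α}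
    (h : ∀ g g', (e g ++ f g', e g ++ e g') ∈ R) (w : List β) (u : List α) (g : β) :
    RewStar R (u ++ e g ++ w.flatMap f) (u ++ e g ++ w.flatMap e) := by
  induction w generalizing u g with
  | nil => exact .refl
  | cons g' w ih =>
    refine .head (b := u ++ e g ++ e g' ++ w.flatMap f) ?_ ?_
    · simpa using OneStep.of_mem (h g g') u (w.flatMap f)
    · simpa [RewStar] using ih (u ++ e g) g'

/-- If moreover a marker `c` starts the recoding, then `c` followed by a word coded by `f`
rewrites to `c` followed by the same word coded by `e`. -/
theorem RewStar.sweep_of_marker {α β : Type*} {R : Set (List α × List α)} {e f : β → List α}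
    {c : List α} (hc : ∀ g, (c ++ f g, c ++ e g) ∈ R)
    (h : ∀ g g', (e g ++ f g', e g ++ e g') ∈ R) (w : List β) :
    RewStar R (c ++ w.flatMap f) (c ++ w.flatMap e) := by
  cases w with
  | nil => exact .refl
  | cons g w =>
    refine .head (b := c ++ e g ++ w.flatMap f) ?_ ?_
    · simpa using OneStep.of_mem (hc g) [] (w.flatMap f)
    · simpa [RewStar] using RewStar.sweep h w c g

/-- Using the Class D rules: `¢₁ h₁(w) →*_S ¢₁ h₃(w)` and
`¢₂ h₁(w) →*_S ¢₂ h₂(w)` for every `w ∈ Γ*`. -/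
theorem classD_reductions (n : ℕ) (x y : Fin (n + 2) → List Γ)
    (hx : ∀ i, x i ≠ []) (hy : ∀ i, y i ≠ []) :
    ∀ w : List Γ,
      RewStar (SSys n x y) ([Ltr.cent1] ++ h1 w) ([Ltr.cent1] ++ h3 w) ∧
      RewStar (SSys n x y) ([Ltr.cent2] ++ h1 w) ([Ltr.cent2] ++ h2 w) := by
  intro w
  constructor
  · refine RewStar.sweep_of_marker (fun g => ?_) (fun g g' => ?_) w
    · simpa [SSys, h1, h3] using SRule.D1 (x := x) (y := y) g
    · simpa [SSys, h1, h3] using SRule.D4 (x := x) (y := y) g g'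
  · refine RewStar.sweep_of_marker (fun g => ?_) (fun g g' => ?_) w
    · simpa [SSys, h1, h2] using SRule.D2 (x := x) (y := y) g
    · simpa [SSys, h1, h2] using SRule.D3 (x := x) (y := y) g g'
end
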